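/- arXiv:2110.05454 — 3 statements merged into one kernel-verified Lean document; each statement's English description precedes it below -/
import Mathlib

section
/- Fix an integer P ≥ 3, β₁, β₂ ∈ (0,1), ε > 0, α₀ > 0. Define the periodic gradient sequence g_t (t ≥ 1) by g_t = P if t mod P = 1 and g_t = −1 otherwise; define m_0 = 0, m_t = β₁ m_{t−1} + (1−β₁) g_t, and S_0 = 0, S_t = β₂ S_{t−1} + (1−β₂)(g_t − m_t)². Let x_0 ∈ [−1, 1] and define the ACProp iterates x_t = clamp( x_{t−1} − (α₀/√t) · g_t/(√(S_{t−1}) + ε), −1, 1 ). Then x_t converges to −1 as t → ∞. -/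
open Filter Topology

/-- An exponential moving average of a decreasing input is unimodal, hence bounded below by the
smaller of its two end values. -/
theorem min_endpoints_le_ema {N : ℕ} {β : ℝ} (hβ0 : 0 ≤ β) (hβ1 : β ≤ 1) {S q : ℕ → ℝ}
    (hS : ∀ j, j < N → S (j + 1) = β * S j + (1 - β) * q j)
    (hq : ∀ j, j + 1 < N → q (j + 1) ≤ q j) {i : ℕ} (hi : i ≤ N) :
    min (S 0) (S N) ≤ S i := by
  by_cases h : ∃ j, j < i ∧ q j ≤ S j
  · obtain ⟨j, hji, hj⟩ := h
    have below : ∀ l, j ≤ l → l < N → q l ≤ S l := by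
      intro l hl
      induction l, hl using Nat.le_induction with
      | base => exact fun _ => hj
      | succ l hl ih =>
        intro hlN
        have h1 := ih (by omega)
        have h2 := hq l hlN
        rw [hS l (by omega)]
        nlinarith
    have decr : ∀ l, i ≤ l → l ≤ N → S l ≤ S i := by
      intro l hl
      induction l, hl using Nat.le_induction with
      | base => exact fun _ => le_rfl
      | succ l hl ih =>
        intro hlN
        have h1 := ih (by omega)
        have h2 := below l (by omega) hlN
        rw [hS l hlN]
        nlinarith
    exact (min_le_right _ _).trans (decr N hi le_rfl)
  · push Not at h
    have incr : ∀ l, l ≤ i → S 0 ≤ S l := by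
      intro l
      induction l with
      | zero => exact fun _ => le_rfl
      | succ l ih =>
        intro hl
        have h1 := ih (by omega)
        have h2 := h l hl
        rw [hS l (by omega)]
        nlinarith
    exact (min_le_left _ _).trans (incr i le_rfl)

/-- A contraction driven by a geometrically decaying perturbation tends to zero. -/
theorem tendsto_zero_of_contraction_add_geometric {β r K : ℝ} (hβ0 : 0 ≤ β) (hβ1 : β < 1)
    (hr0 : 0 ≤ r) (hr1 : r < 1) (hK : 0 ≤ K) {v : ℕ → ℝ}
    (hv : ∀ t, |v (t + 1)| ≤ β * |v t| + K * r ^ t) : Tendsto v atTop (𝓝 0) := by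
  obtain ⟨γ, hγ, hγ1⟩ := exists_between (max_lt hβ1 hr1)
  have hβγ : β < γ := (le_max_left _ _).trans_lt hγ
  have hrγ : r < γ := (le_max_right _ _).trans_lt hγ
  have hγ0 : 0 ≤ γ := hβ0.trans hβγ.le
  set L := max |v 0| (K / (γ - β)) with hL
  have hKL : K ≤ L * (γ - β) := by
    rw [← div_le_iff₀ (sub_pos.2 hβγ)]
    exact le_max_right _ _
  have bound : ∀ t, |v t| ≤ L * γ ^ t := by
    intro t
    induction t with
    | zero => simp [hL]
    | succ t ih =>
      have hpow : r ^ t ≤ γ ^ t := pow_le_pow_left₀ hr0 hrγ.le t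
      have h1 : K * r ^ t ≤ L * (γ - β) * γ ^ t :=
        mul_le_mul hKL hpow (pow_nonneg hr0 t) (hK.trans hKL)
      have h2 := mul_le_mul_of_nonneg_left ih hβ0
      have h3 := hv t
      rw [pow_succ]
      linarith
  refine squeeze_zero_norm bound ?_
  simpa using (tendsto_pow_atTop_nhds_zero_of_lt_one hγ0 hγ1).const_mul L

/-- Descent with vanishing, non-summable steps towards a lower bound converges to that bound. -/
theorem tendsto_of_descent {l C c : ℝ} {z η : ℕ → ℝ} (hc : 0 < c) (hz : ∀ k, l ≤ z k)
    (hη0 : ∀ k, 0 ≤ η k) (hη : Tendsto η atTop (𝓝 0))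
    (hsum : Tendsto (fun n => ∑ i ∈ Finset.range n, η i) atTop atTop)
    (hstep : ∀ᶠ k in atTop, z (k + 1) ≤ max (l + C * η k) (z k - c * η k)) :
    Tendsto z atTop (𝓝 l) := by
  rw [tendsto_order]
  refine ⟨fun a ha => Eventually.of_forall fun k => ha.trans_le (hz k), fun a ha => ?_⟩
  have hC : ∀ᶠ k in atTop, C * η k < a - l := by
    have h : Tendsto (fun k => C * η k) atTop (𝓝 0) := by simpa using hη.const_mul C
    exact h.eventually_lt_const (sub_pos.2 ha)
  obtain ⟨N, hN⟩ := eventually_atTop.1 (hstep.and hC)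
  obtain ⟨n, hn, hna⟩ : ∃ n, N ≤ n ∧ z n < a := by
    by_contra! hcon
    have tele : ∀ n, N ≤ n → z n + c * ∑ i ∈ Finset.range n, η i ≤
        z N + c * ∑ i ∈ Finset.range N, η i := by
      intro n hn
      induction n, hn using Nat.le_induction with
      | base => exact le_rfl
      | succ n hn ih =>
        obtain ⟨h1, h2⟩ := hN n hn
        have h3 := hcon (n + 1) (by omega)
        rw [Finset.sum_range_succ]
        rcases le_max_iff.1 h1 with h | h <;> linarith
    obtain ⟨n, hn1, hn2⟩ := ((hsum.const_mul_atTop hc).eventually_gt_atTop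
      (z N + c * ∑ i ∈ Finset.range N, η i - l) |>.and (eventually_ge_atTop N)).exists
    have h1 := tele n hn2
    have h2 := hz n
    linarith
  refine eventually_atTop.2 ⟨n, fun k hk => ?_⟩
  induction k, hk using Nat.le_induction with
  | base => exact hna
  | succ k hk ih =>
    obtain ⟨h1, h2⟩ := hN k (hn.trans hk)
    have h3 := mul_nonneg hc.le (hη0 k)
    rcases le_max_iff.1 h1 with h | h <;> linarith

section Reddi

variable {P : ℕ} {β : ℝ} {g m : ℕ → ℝ}

/-- Between two spikes the momentum relaxes geometrically towards `-1`. -/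
theorem momentum_add_one_eq (hg : ∀ k j, j < P → g (k * P + j + 1) = if j = 0 then (P : ℝ) else -1)
    (hm : ∀ t, m (t + 1) = β * m t + (1 - β) * g (t + 1)) (k : ℕ) {j : ℕ} (hj : j < P) :
    m (k * P + j + 1) + 1 = β ^ j * (β * (m (k * P) + 1) + (1 - β) * (P + 1)) := by
  induction j with
  | zero =>
    have h := hg k 0 hj
    rw [if_pos rfl] at h
    rw [hm, h]
    ring
  | succ j ih =>
    have h := hg k (j + 1) hj
    rw [if_neg (by omega)] at h
    have h1 := ih (by omega)
    rw [hm, h, pow_succ, ← add_assoc]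
    linear_combination β * h1

theorem neg_one_le_momentum (hβ0 : 0 ≤ β) (hβ1 : β ≤ 1) (hm0 : m 0 = 0)
    (hglow : ∀ t, -1 ≤ g (t + 1)) (hm : ∀ t, m (t + 1) = β * m t + (1 - β) * g (t + 1)) (t : ℕ) :
    -1 ≤ m t := by
  induction t with
  | zero => simp [hm0]
  | succ t ih =>
    rw [hm]
    nlinarith [hglow t]

theorem momentum_le (hβ0 : 0 ≤ β) (hβ1 : β ≤ 1) (hm0 : m 0 = 0)
    (hgup : ∀ t, g (t + 1) ≤ P) (hm : ∀ t, m (t + 1) = β * m t + (1 - β) * g (t + 1)) (t : ℕ) :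
    m t ≤ P := by
  induction t with
  | zero => simp [hm0]
  | succ t ih =>
    rw [hm]
    nlinarith [hgup t]

/-- From the end of the first period on, the momentum just before a spike is small enough for the
deviation at the spike to dominate the deviation right after it. -/
theorem momentum_at_period_end_le (hP : 3 ≤ P) (hβ0 : 0 < β) (hβ1 : β < 1) (hm0 : m 0 = 0)
    (hg : ∀ k j, j < P → g (k * P + j + 1) = if j = 0 then (P : ℝ) else -1)
    (hm : ∀ t, m (t + 1) = β * m t + (1 - β) * g (t + 1)) (k : ℕ) :
    (m ((k + 1) * P) + 1) * (1 + β) ≤ β * (P + 1) := by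
  have hP' : (3 : ℝ) ≤ P := by exact_mod_cast hP
  obtain ⟨Q, rfl⟩ : ∃ Q, P = Q + 3 := ⟨P - 3, by omega⟩
  have hrec : ∀ k, m ((k + 1) * (Q + 3)) + 1 =
      β ^ (Q + 2) * (β * (m (k * (Q + 3)) + 1) + (1 - β) * ((Q + 3 : ℕ) + 1)) := by
    intro k
    rw [← momentum_add_one_eq hg hm k (j := Q + 2) (by omega)]
    congr 2
    ring
  set R : ℝ := ((Q + 3 : ℕ) : ℝ)
  have hpow : β ^ (Q + 2) ≤ β ^ 2 := pow_le_pow_of_le_one hβ0.le hβ1.le (by omega)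
  have key : ∀ w : ℝ, 0 ≤ β * w + (1 - β) * (R + 1) →
      β ^ 2 * (β * w + (1 - β) * (R + 1)) * (1 + β) ≤ β * (R + 1) →
      β ^ (Q + 2) * (β * w + (1 - β) * (R + 1)) * (1 + β) ≤ β * (R + 1) := by
    intro w hw h
    refine le_trans ?_ h
    gcongr
  have hmlow : ∀ k, 0 ≤ m (k * (Q + 3)) + 1 := by
    intro k
    induction k with
    | zero => simp [hm0]
    | succ k ih =>
      rw [hrec]
      have : 0 ≤ 1 - β := by linarith
      positivity
  have hnn : ∀ k, 0 ≤ β * (m (k * (Q + 3)) + 1) + (1 - β) * (R + 1) := by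
    intro k
    have h1 := hmlow k
    have : 0 ≤ 1 - β := by linarith
    positivity
  induction k with
  | zero =>
    rw [hrec]
    refine key _ (hnn 0) ?_
    simp only [zero_mul, hm0, zero_add, mul_one]
    have h1 : β * (1 - β ^ 2) ≤ 1 / 2 := by nlinarith [sq_nonneg (β - 1 / 2), sq_nonneg β]
    have h2 : β ^ 2 * (1 + β) ≤ 2 := by nlinarith [mul_pos hβ0 hβ0]
    have h3 : β * (1 - β ^ 2) * (R + 1) ≤ 1 / 2 * (R + 1) := by gcongr
    have h4 := mul_le_mul_of_nonneg_left (add_le_add h2 h3) hβ0.le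
    nlinarith
  | succ k ih =>
    rw [hrec]
    refine key _ (hnn (k + 1)) ?_
    have h1 := mul_le_mul_of_nonneg_left ih (pow_nonneg hβ0.le 3)
    have h3 : β ^ 3 * (β * (R + 1)) + β ^ 2 * (1 - β) * (1 + β) * (R + 1) ≤ β * (R + 1) := by
      have h4 : 0 ≤ β * (1 - β) * (R + 1) := by
        have : 0 ≤ 1 - β := by linarith
        positivity
      linarith
    linarith

/-- After the first period, the squared deviations `(g t - m t) ^ 2` decrease within each period. -/
theorem sq_deviation_antitone (hP : 3 ≤ P) (hβ0 : 0 < β) (hβ1 : β < 1) (hm0 : m 0 = 0)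
    (hg : ∀ k j, j < P → g (k * P + j + 1) = if j = 0 then (P : ℝ) else -1)
    (hgup : ∀ t, g (t + 1) ≤ P)
    (hm : ∀ t, m (t + 1) = β * m t + (1 - β) * g (t + 1)) (k : ℕ) {j : ℕ} (hj : j + 1 < P) :
    (g ((k + 1) * P + (j + 1) + 1) - m ((k + 1) * P + (j + 1) + 1)) ^ 2 ≤
      (g ((k + 1) * P + j + 1) - m ((k + 1) * P + j + 1)) ^ 2 := by
  have hg1 := hg (k + 1) (j + 1) hj
  have hg0 := hg (k + 1) j (by omega)
  rw [if_neg (by omega)] at hg1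
  have hm1 := hm ((k + 1) * P + (j + 1))
  rw [hg1] at hm1
  rw [← add_assoc] at hm1 hg1 ⊢
  rw [hg1, hm1]
  rcases Nat.eq_zero_or_pos j with rfl | hj0
  · have hend := momentum_at_period_end_le hP hβ0 hβ1 hm0 hg hm k
    have hle := momentum_le hβ0.le hβ1.le hm0 hgup hm ((k + 1) * P)
    have hspike := hm ((k + 1) * P)
    simp only [if_true, add_zero] at hg0 ⊢
    rw [hg0] at hspike ⊢
    rw [hspike]
    have hR : (0 : ℝ) ≤ P := Nat.cast_nonneg P
    set w := m ((k + 1) * P)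
    apply sq_le_sq'
    · nlinarith [mul_le_mul_of_nonneg_left hend hβ0.le]
    · nlinarith [mul_nonneg hβ0.le (sub_nonneg.2 hle),
        mul_nonneg hβ0.le (mul_nonneg (sub_nonneg.2 hβ1.le) (sub_nonneg.2 hle))]
  · rw [if_neg (by omega)] at hg0
    rw [hg0]
    set w := m ((k + 1) * P + j + 1)
    have h1 : (-1 - (β * w + (1 - β) * -1)) ^ 2 = β ^ 2 * (-1 - w) ^ 2 := by ring
    rw [h1]
    exact mul_le_of_le_one_left (sq_nonneg _) (pow_le_one₀ hβ0.le hβ1.le)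

/-- The running variance is asymptotically `P`-periodic. -/
theorem tendsto_variance_period_sub {β₂ : ℝ} {S : ℕ → ℝ} (hβ0 : 0 < β) (hβ1 : β < 1)
    (hβ₂0 : 0 < β₂) (hβ₂1 : β₂ < 1) (hm0 : m 0 = 0)
    (hglow : ∀ t, -1 ≤ g (t + 1)) (hgup : ∀ t, g (t + 1) ≤ P)
    (hper : ∀ t, g (t + 1 + P) = g (t + 1))
    (hm : ∀ t, m (t + 1) = β * m t + (1 - β) * g (t + 1))
    (hS : ∀ t, S (t + 1) = β₂ * S t + (1 - β₂) * (g (t + 1) - m (t + 1)) ^ 2) :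
    Tendsto (fun t => S (t + P) - S t) atTop (𝓝 0) := by
  have hdiff : ∀ t, m (t + P) - m t = β ^ t * m P := by
    intro t
    induction t with
    | zero => simp [hm0]
    | succ t ih =>
      have h := hm (t + P)
      rw [add_right_comm t P 1, hper] at h
      rw [h, hm t, pow_succ]
      linear_combination β * ih
  have hdev : ∀ t, |g (t + 1) - m (t + 1)| ≤ P + 1 := by
    intro t
    have h1 := neg_one_le_momentum hβ0.le hβ1.le hm0 hglow hm (t + 1)
    have h2 := momentum_le hβ0.le hβ1.le hm0 hgup hm (t + 1)
    have h3 := hglow t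
    have h4 := hgup t
    rw [abs_le]
    constructor <;> linarith
  have hK : (0 : ℝ) ≤ |m P| * (2 * (P + 1)) := by positivity
  refine tendsto_zero_of_contraction_add_geometric hβ₂0.le hβ₂1 hβ0.le hβ1 hK fun t => ?_
  have hSP := hS (t + P)
  have hdP := hdev (t + P)
  rw [add_right_comm t P 1, hper] at hSP hdP
  have hd := hdev t
  have hdt := hdiff (t + 1)
  set a := g (t + 1) - m (t + 1)
  set b := g (t + 1) - m (t + 1 + P)
  have hab : b - a = -(β ^ (t + 1) * m P) := by rw [← hdt]; ring
  have hsq : |b ^ 2 - a ^ 2| ≤ |m P| * (2 * (P + 1)) * β ^ t := by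
    have h1 : b ^ 2 - a ^ 2 = (b - a) * (b + a) := by ring
    have h2 : |b + a| ≤ 2 * (P + 1) := (abs_add_le b a).trans (by linarith)
    have h3 : β ^ (t + 1) ≤ β ^ t := pow_le_pow_of_le_one hβ0.le hβ1.le (by omega)
    rw [h1, abs_mul, hab, abs_neg, abs_mul, abs_of_nonneg (pow_nonneg hβ0.le _)]
    calc β ^ (t + 1) * |m P| * |b + a| ≤ β ^ t * |m P| * (2 * (P + 1)) := by gcongr
      _ = _ := by ring
  have hrec : S (t + 1 + P) - S (t + 1) =
      β₂ * (S (t + P) - S t) + (1 - β₂) * (b ^ 2 - a ^ 2) := by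
    rw [hSP, hS t]
    ring
  rw [hrec]
  refine (abs_add_le _ _).trans ?_
  rw [abs_mul, abs_mul, abs_of_pos hβ₂0, abs_of_pos (sub_pos.2 hβ₂1)]
  have := mul_le_of_le_one_left (abs_nonneg (b ^ 2 - a ^ 2)) (by linarith : 1 - β₂ ≤ 1)
  linarith

theorem variance_mem_Icc {β₂ : ℝ} {S : ℕ → ℝ} (hβ0 : 0 ≤ β) (hβ1 : β ≤ 1)
    (hβ₂0 : 0 ≤ β₂) (hβ₂1 : β₂ ≤ 1) (hm0 : m 0 = 0) (hS0 : S 0 = 0)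
    (hglow : ∀ t, -1 ≤ g (t + 1)) (hgup : ∀ t, g (t + 1) ≤ P)
    (hm : ∀ t, m (t + 1) = β * m t + (1 - β) * g (t + 1))
    (hS : ∀ t, S (t + 1) = β₂ * S t + (1 - β₂) * (g (t + 1) - m (t + 1)) ^ 2) (t : ℕ) :
    S t ∈ Set.Icc (0 : ℝ) ((P + 1) ^ 2) := by
  induction t with
  | zero =>
    rw [hS0]
    exact ⟨le_rfl, by positivity⟩
  | succ t ih =>
    have h1 := neg_one_le_momentum hβ0 hβ1 hm0 hglow hm (t + 1)
    have h2 := momentum_le hβ0 hβ1 hm0 hgup hm (t + 1)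
    have h3 := hglow t
    have h4 := hgup t
    have h5 : (g (t + 1) - m (t + 1)) ^ 2 ≤ ((P : ℝ) + 1) ^ 2 := by
      apply sq_le_sq' <;> linarith
    rw [hS]
    constructor
    · nlinarith [ih.1, mul_nonneg (sub_nonneg.2 hβ₂1) (sq_nonneg (g (t + 1) - m (t + 1)))]
    · nlinarith [ih.2]

end Reddi

/-- Growth of a sequence over one period consisting of one controlled step followed by steps of
size at most `b`. -/
theorem le_of_first_step_of_increments {N : ℕ} {u : ℕ → ℝ} {a b : ℝ} (hb : 0 ≤ b)
    (hfirst : u 1 ≤ a) (hnext : ∀ j, 1 ≤ j → j < N → u (j + 1) ≤ u j + b) {j : ℕ} (hj1 : 1 ≤ j)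
    (hj : j ≤ N) : u j ≤ a + (N - 1) * b := by
  have h : ∀ i, 1 ≤ i → i ≤ N → u i ≤ a + (i - 1) * b := by
    intro i hi
    induction i, hi using Nat.le_induction with
    | base => simpa using fun _ => hfirst
    | succ i hi ih =>
      intro hiN
      have h1 := ih (by omega)
      have h2 := hnext i hi hiN
      push_cast
      linarith
  have hjN : (j : ℝ) ≤ N := by exact_mod_cast hj
  have := h j hj1 hj
  nlinarith

/-- If the gaps between two nonnegative sequences vanish, so do the gaps between the corresponding
preconditioners `1 / (√· + ε)`. -/
theorem tendsto_one_div_sqrt_add_sub {a b : ℕ → ℝ} {ε : ℝ} (hε : 0 < ε) (hb : ∀ k, 0 ≤ b k)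
    (ha : ∀ k, 0 ≤ a k) (h : Tendsto (fun k => b k - a k) atTop (𝓝 0)) :
    Tendsto (fun k => 1 / (√(b k) + ε) - 1 / (√(a k) + ε)) atTop (𝓝 0) := by
  have hsqrt : ∀ {x y : ℝ}, 0 ≤ y → √x - √y ≤ √|x - y| := by
    intro x y hy
    rw [sub_le_iff_le_add, Real.sqrt_le_left (by positivity)]
    nlinarith [Real.sq_sqrt hy, Real.sq_sqrt (abs_nonneg (x - y)), le_abs_self (x - y),
      mul_nonneg (Real.sqrt_nonneg |x - y|) (Real.sqrt_nonneg y)]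
  have hbound : ∀ k, ‖1 / (√(b k) + ε) - 1 / (√(a k) + ε)‖ ≤ √|b k - a k| / ε ^ 2 := by
    intro k
    have hx := Real.sqrt_nonneg (a k)
    have hy := Real.sqrt_nonneg (b k)
    have hdiff : |√(a k) - √(b k)| ≤ √|b k - a k| := by
      rw [abs_sub_le_iff]
      exact ⟨by simpa [abs_sub_comm] using hsqrt (x := a k) (hb k), hsqrt (ha k)⟩
    have heq : 1 / (√(b k) + ε) - 1 / (√(a k) + ε) =
        (√(a k) - √(b k)) / ((√(b k) + ε) * (√(a k) + ε)) := by
      field_simp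
      ring
    rw [heq, Real.norm_eq_abs, abs_div, abs_of_pos (a := (√(b k) + ε) * (√(a k) + ε)) (by positivity)]
    gcongr
    nlinarith [mul_nonneg hx hy, mul_nonneg hx hε.le, mul_nonneg hy hε.le]
  refine squeeze_zero_norm hbound ?_
  have h1 : Tendsto (fun k => √|b k - a k|) atTop (𝓝 0) := by
    simpa [Function.comp_def] using (Real.continuous_sqrt.tendsto _).comp h.abs
  simpa using h1.div_const (ε ^ 2)

theorem tendsto_sum_div_sqrt_atTop {P : ℕ} (hP : 1 ≤ P) {α : ℝ} (hα : 0 < α) :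
    Tendsto (fun n => ∑ k ∈ Finset.range n, α / √((k * P + 1 : ℕ) : ℝ)) atTop atTop := by
  have hP' : (1 : ℝ) ≤ P := by exact_mod_cast hP
  have hP0 : (0 : ℝ) < P := by linarith
  refine tendsto_atTop_mono (fun n => ?_)
    (Real.tendsto_sum_range_one_div_nat_succ_atTop.const_mul_atTop (div_pos hα hP0))
  rw [Finset.mul_sum]
  refine Finset.sum_le_sum fun k _ => ?_
  have h1 : (1 : ℝ) ≤ ((k * P + 1 : ℕ) : ℝ) := by exact_mod_cast Nat.le_add_left 1 _
  have h2 : √((k * P + 1 : ℕ) : ℝ) ≤ P * (k + 1) := by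
    rw [Real.sqrt_le_left (by positivity)]
    have h3 : ((k * P + 1 : ℕ) : ℝ) ≤ P * (k + 1) := by
      push_cast
      linarith
    nlinarith
  rw [div_mul_div_comm, mul_one]
  gcongr

theorem tendsto_div_sqrt_zero {P : ℕ} (hP : 1 ≤ P) (α : ℝ) :
    Tendsto (fun k : ℕ => α / √((k * P + 1 : ℕ) : ℝ)) atTop (𝓝 0) := by
  have h : Tendsto (fun k : ℕ => k * P + 1) atTop atTop :=
    tendsto_atTop_mono (fun k => (Nat.le_mul_of_pos_right k hP).trans (Nat.le_succ _)) tendsto_id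
  exact ((Real.tendsto_sqrt_atTop.comp tendsto_natCast_atTop_atTop).comp h).const_div_atTop α

/-- ACProp always converges on the Reddi et al. counterexample:
`g_t = P` if `t mod P = 1`, else `-1`; iterates clamped to `[-1, 1]` converge to `-1`. -/
theorem acprop_always_converges_reddi_example
    (P : ℕ) (hP : 3 ≤ P) (β₁ β₂ : ℝ)
    (hβ₁ : β₁ ∈ Set.Ioo (0 : ℝ) 1) (hβ₂ : β₂ ∈ Set.Ioo (0 : ℝ) 1)
    (ε α₀ : ℝ) (hε : 0 < ε) (hα₀ : 0 < α₀)
    (g m S x : ℕ → ℝ)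
    (hg : ∀ t, 1 ≤ t → g t = if t % P = 1 then (P : ℝ) else -1)
    (hm0 : m 0 = 0)
    (hm : ∀ t, 1 ≤ t → m t = β₁ * m (t - 1) + (1 - β₁) * g t)
    (hS0 : S 0 = 0)
    (hS : ∀ t, 1 ≤ t → S t = β₂ * S (t - 1) + (1 - β₂) * (g t - m t) ^ 2)
    (hx0 : x 0 ∈ Set.Icc (-1 : ℝ) 1)
    (hx : ∀ t, 1 ≤ t →
      x t = max (-1) (min 1
        (x (t - 1) - (α₀ / Real.sqrt t) * (g t / (Real.sqrt (S (t - 1)) + ε))))) :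
    Filter.Tendsto x Filter.atTop (nhds (-1)) := by
  obtain ⟨hβ₁0, hβ₁1⟩ := hβ₁
  obtain ⟨hβ₂0, hβ₂1⟩ := hβ₂
  have hR : (3 : ℝ) ≤ P := by exact_mod_cast hP
  have hgp : ∀ k j, j < P → g (k * P + j + 1) = if j = 0 then (P : ℝ) else -1 := by
    intro k j hj
    rw [hg _ (by omega), add_assoc, Nat.mul_add_mod_self_right]
    rcases Nat.lt_or_ge (j + 1) P with h | h
    · rw [Nat.mod_eq_of_lt h]
      simp
    · obtain rfl : P = j + 1 := by omega
      rw [Nat.mod_self, if_neg (by omega), if_neg (by omega)]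
  have hglow : ∀ t, -1 ≤ g (t + 1) := by
    intro t
    rw [hg _ (by omega)]
    split_ifs <;> linarith
  have hgup : ∀ t, g (t + 1) ≤ P := by
    intro t
    rw [hg _ (by omega)]
    split_ifs <;> linarith
  have hper : ∀ t, g (t + 1 + P) = g (t + 1) := by
    intro t
    rw [hg _ (by omega), hg _ (by omega), Nat.add_mod_right]
  replace hm : ∀ t, m (t + 1) = β₁ * m t + (1 - β₁) * g (t + 1) := fun t => hm (t + 1) (by omega)
  replace hS : ∀ t, S (t + 1) = β₂ * S t + (1 - β₂) * (g (t + 1) - m (t + 1)) ^ 2 :=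
    fun t => hS (t + 1) (by omega)
  replace hx : ∀ t, x (t + 1) = max (-1) (min 1
      (x t - (α₀ / √((t + 1 : ℕ) : ℝ)) * (g (t + 1) / (√(S t) + ε)))) :=
    fun t => hx (t + 1) (by omega)
  have hSmem := variance_mem_Icc hβ₁0.le hβ₁1.le hβ₂0.le hβ₂1.le hm0 hS0 hglow hgup hm hS
  have hxlow : ∀ t, -1 ≤ x t := by
    rintro (_ | t)
    · exact hx0.1
    · rw [hx]
      exact le_max_left _ _
  set η : ℕ → ℝ := fun k => α₀ / √((k * P + 1 : ℕ) : ℝ) with hη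
  have hη0 : ∀ k, 0 ≤ η k := fun k => by positivity
  have hηlim : Tendsto η atTop (𝓝 0) := tendsto_div_sqrt_zero (by omega) α₀
  set A : ℕ → ℝ := fun k => 1 / (√(S (k * P)) + ε) with hA
  have hA0 : ∀ k, 0 ≤ A k := fun k => by positivity
  have hAup : ∀ k, A k ≤ 1 / ε := fun k =>
    one_div_le_one_div_of_le hε (by linarith [Real.sqrt_nonneg (S (k * P))])
  have hAlow : ∀ k, 1 / ((P : ℝ) + 1 + ε) ≤ A k := by
    intro k
    have : √(S (k * P)) ≤ P + 1 := (Real.sqrt_le_left (by positivity)).2 (hSmem _).2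
    exact one_div_le_one_div_of_le (by positivity) (by linarith)
  have hAdiff : Tendsto (fun k => A (k + 1) - A k) atTop (𝓝 0) := by
    refine tendsto_one_div_sqrt_add_sub hε (fun k => (hSmem _).1) (fun k => (hSmem _).1) ?_
    have hmul : Tendsto (fun k : ℕ => k * P) atTop atTop :=
      tendsto_atTop_mono (fun k => Nat.le_mul_of_pos_right k (by omega)) tendsto_id
    refine ((tendsto_variance_period_sub hβ₁0 hβ₁1 hβ₂0 hβ₂1 hm0 hglow hgup hper hm hS).comp
      hmul).congr fun k => ?_
    simp only [Function.comp, Nat.succ_mul]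
  have hpre : ∀ k, 1 ≤ k → ∀ j, j ≤ P → 1 / (√(S (k * P + j)) + ε) ≤ max (A k) (A (k + 1)) := by
    intro k hk j hj
    obtain ⟨k, rfl⟩ : ∃ i, k = i + 1 := ⟨k - 1, by omega⟩
    have h := min_endpoints_le_ema hβ₂0.le hβ₂1.le (N := P) (S := fun j => S ((k + 1) * P + j))
      (q := fun j => (g ((k + 1) * P + j + 1) - m ((k + 1) * P + j + 1)) ^ 2)
      (fun j _ => hS _)
      (fun j hj => sq_deviation_antitone hP hβ₁0 hβ₁1 hm0 hgp hgup hm k hj) hj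
    simp only [add_zero, ← Nat.succ_mul] at h
    have hanti : ∀ {a : ℝ}, a ≤ S ((k + 1) * P + j) →
        1 / (√(S ((k + 1) * P + j)) + ε) ≤ 1 / (√a + ε) := by
      intro a ha
      exact one_div_le_one_div_of_le (by positivity) (by linarith [Real.sqrt_le_sqrt ha])
    rcases min_le_iff.1 h with h | h
    · exact le_max_of_le_left (hanti h)
    · exact le_max_of_le_right (hanti h)
  have hperiod : ∀ k, 1 ≤ k → ∀ j, 1 ≤ j → j ≤ P → x (k * P + j) ≤
      max (-1) (x (k * P) - η k * (P * A k)) + (P - 1) * (η k * max (A k) (A (k + 1))) := by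
    intro k hk j hj1 hj
    refine le_of_first_step_of_increments (u := fun j => x (k * P + j))
      (mul_nonneg (hη0 k) (le_max_of_le_left (hA0 k))) ?_ ?_ hj1 hj
    · have hg0 := hgp k 0 (by omega)
      rw [if_pos rfl, add_zero] at hg0
      simp only [hx, hg0]
      refine max_le_max le_rfl ((min_le_right _ _).trans_eq ?_)
      simp only [hη, hA]
      ring
    · intro i hi1 hi
      have hgi := hgp k i hi
      rw [if_neg (by omega)] at hgi
      have hstep : α₀ / √((k * P + i + 1 : ℕ) : ℝ) ≤ η k := by
        simp only [hη]
        have : ((k * P + 1 : ℕ) : ℝ) ≤ ((k * P + i + 1 : ℕ) : ℝ) := by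
          exact_mod_cast (by omega : k * P + 1 ≤ k * P + i + 1)
        gcongr
      have hmul := mul_le_mul hstep (hpre k hk i hi.le) (by positivity) (hη0 k)
      have hnn : 0 ≤ η k * max (A k) (A (k + 1)) :=
        mul_nonneg (hη0 k) (le_max_of_le_left (hA0 k))
      simp only [← add_assoc, hx (k * P + i), hgi]
      refine max_le (by linarith [hxlow (k * P + i)]) ((min_le_right _ _).trans ?_)
      rw [neg_div, mul_neg, sub_neg_eq_add]
      linarith
  have hinc : ∀ k, (P - 1) * (η k * max (A k) (A (k + 1))) ≤ P / ε * η k := by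
    intro k
    have h1 : max (A k) (A (k + 1)) ≤ 1 / ε := max_le (hAup _) (hAup _)
    calc (P - 1) * (η k * max (A k) (A (k + 1))) ≤ P * (η k * (1 / ε)) := by
          have := hη0 k
          have := le_max_of_le_left (b := A k) (c := A (k + 1)) (hA0 k)
          gcongr
          linarith
      _ = P / ε * η k := by ring
  set c : ℝ := 1 / (2 * ((P : ℝ) + 1 + ε)) with hc
  have hc0 : 0 < c := by positivity
  have hdescent : ∀ᶠ k in atTop, x ((k + 1) * P) ≤
      max (-1 + P / ε * η k) (x (k * P) - c * η k) := by
    have hsmall : ∀ᶠ k in atTop, (P - 1) * |A (k + 1) - A k| < c := by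
      have h : Tendsto (fun k => ((P : ℝ) - 1) * |A (k + 1) - A k|) atTop (𝓝 0) := by
        simpa using hAdiff.abs.const_mul ((P : ℝ) - 1)
      exact h.eventually_lt_const hc0
    filter_upwards [hsmall, eventually_ge_atTop 1] with k hk hk1
    have h := hperiod k hk1 P (by omega) le_rfl
    rw [← Nat.succ_mul] at h
    refine h.trans ?_
    rw [max_add]
    refine max_le_max (by linarith [hinc k]) ?_
    have h1 : max (A k) (A (k + 1)) ≤ A k + |A (k + 1) - A k| :=
      max_le (by linarith [abs_nonneg (A (k + 1) - A k)]) (by linarith [le_abs_self (A (k + 1) - A k)])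
    have h2 : (P - 1) * max (A k) (A (k + 1)) ≤ (P - 1) * (A k + |A (k + 1) - A k|) :=
      mul_le_mul_of_nonneg_left h1 (by linarith)
    have h3 : 2 * c ≤ A k := by
      refine le_trans (le_of_eq ?_) (hAlow k)
      rw [hc]
      field_simp
    have h4 : c ≤ P * A k - (P - 1) * max (A k) (A (k + 1)) := by linarith
    have h5 := mul_le_mul_of_nonneg_left h4 (hη0 k)
    linarith
  have hends : Tendsto (fun k => x (k * P)) atTop (𝓝 (-1)) :=
    tendsto_of_descent hc0 (fun k => hxlow _) hη0 hηlim
      (tendsto_sum_div_sqrt_atTop (by omega) hα₀) hdescent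
  have hupper : Tendsto (fun k => x (k * P) + P / ε * η k) atTop (𝓝 (-1)) := by
    simpa using hends.add (hηlim.const_mul (P / ε))
  have hdiv : Tendsto (fun t : ℕ => t / P) atTop atTop := Nat.tendsto_div_const_atTop (by omega)
  refine tendsto_of_tendsto_of_tendsto_of_le_of_le' tendsto_const_nhds (hupper.comp hdiv)
    (Eventually.of_forall hxlow) ?_
  filter_upwards [hdiv.eventually_ge_atTop 1] with t ht
  simp only [Function.comp]
  rcases Nat.eq_zero_or_pos (t % P) with h0 | h0
  · have : t = t / P * P := by
      have := Nat.div_add_mod' t P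
      omega
    rw [← this]
    have := mul_nonneg (by positivity : (0 : ℝ) ≤ P / ε) (hη0 (t / P))
    linarith
  · have h := hperiod (t / P) ht (t % P) h0 (Nat.mod_lt _ (by omega)).le
    rw [Nat.div_add_mod'] at h
    have h1 : max (-1) (x (t / P * P) - η (t / P) * (P * A (t / P))) ≤ x (t / P * P) :=
      max_le (hxlow _) (sub_le_self _
        (mul_nonneg (hη0 _) (mul_nonneg (Nat.cast_nonneg P) (hA0 _))))
    linarith [hinc (t / P)]
end

section
/- Fix an integer P ≥ 3 and β₁ ∈ (0,1). Define the periodic gradient sequence g_t (t ≥ 1) by g_t = P if t mod P = 1 and g_t = −1 otherwise, and define m_0 = 0, m_t = β₁ m_{t−1} + (1−β₁) g_t. Then lim_{k→∞} m_{kP} = ((P+1) β₁^{P−1} − P β₁^{P} − 1) / (1 − β₁^{P}). -/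
/-- A sequence with `u (k + 1) = r * u k + c` and `|r| < 1` converges to the fixed point
`c / (1 - r)`. -/
theorem tendsto_of_affine_recurrence {u : ℕ → ℝ} {r c : ℝ} (hr : |r| < 1)
    (hu : ∀ k, u (k + 1) = r * u k + c) :
    Filter.Tendsto u Filter.atTop (nhds (c / (1 - r))) := by
  have hr' : 1 - r ≠ 0 := by linarith [(abs_lt.mp hr).2]
  have closed : ∀ k, u k = r ^ k * (u 0 - c / (1 - r)) + c / (1 - r) := by
    intro k
    induction k with
    | zero => ring
    | succ k ih =>
      rw [hu, ih]
      field_simp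
      ring
  rw [funext closed]
  simpa using ((tendsto_pow_atTop_nhds_zero_of_abs_lt_one hr).mul_const
    (u 0 - c / (1 - r))).add_const (c / (1 - r))

/-- The value of the EMA inside a period, in terms of its value at the start of that period. -/
theorem ema_within_period {P : ℕ} (hP : 2 ≤ P) {β : ℝ} {g m : ℕ → ℝ}
    (hg : ∀ t, 1 ≤ t → g t = if t % P = 1 then (P : ℝ) else -1)
    (hm : ∀ t, 1 ≤ t → m t = β * m (t - 1) + (1 - β) * g t) (k j : ℕ) (hj : j < P) :
    m (k * P + j + 1)
      = β ^ (j + 1) * m (k * P) + (1 - β) * P * β ^ j - (1 - β ^ j) := by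
  induction j with
  | zero =>
    have hmod : (k * P + 0 + 1) % P = 1 := by
      rw [add_zero, mul_comm, Nat.mul_add_mod, Nat.mod_eq_of_lt hP]
    rw [hm _ (by omega), hg _ (by omega), if_pos hmod]
    simp
  | succ j ih =>
    have hmod : (k * P + (j + 1) + 1) % P ≠ 1 := by
      rw [add_assoc, mul_comm, Nat.mul_add_mod]
      rcases (show j + 1 + 1 ≤ P by omega).lt_or_eq with h | h
      · rw [Nat.mod_eq_of_lt h]
        omega
      · simp [h]
    rw [hm _ (by omega), hg _ (by omega), if_neg hmod, Nat.add_sub_cancel, ← add_assoc,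
      ih (by omega)]
    ring

/-- Limit of the EMA `m` of the periodic gradient sequence at multiples of the period. -/
theorem ema_periodic_limit
    (P : ℕ) (hP : 3 ≤ P) (β₁ : ℝ) (hβ₁ : β₁ ∈ Set.Ioo (0 : ℝ) 1)
    (g m : ℕ → ℝ)
    (hg : ∀ t, 1 ≤ t → g t = if t % P = 1 then (P : ℝ) else -1)
    (hm0 : m 0 = 0)
    (hm : ∀ t, 1 ≤ t → m t = β₁ * m (t - 1) + (1 - β₁) * g t) :
    Filter.Tendsto (fun k => m (k * P)) Filter.atTop
      (nhds ((((P : ℝ) + 1) * β₁ ^ (P - 1) - (P : ℝ) * β₁ ^ P - 1) / (1 - β₁ ^ P))) := by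
  have hpow : |β₁ ^ P| < 1 := by
    rw [abs_of_nonneg (pow_nonneg hβ₁.1.le P)]
    exact pow_lt_one₀ hβ₁.1.le hβ₁.2 (by omega)
  refine tendsto_of_affine_recurrence hpow fun k => ?_
  obtain ⟨n, rfl⟩ : ∃ n, P = n + 1 := ⟨P - 1, by omega⟩
  have h := ema_within_period (by omega) hg hm k n (by omega)
  rw [add_assoc] at h
  rw [Nat.succ_mul, h, Nat.add_sub_cancel]
  ring
end

section
/- Fix an integer P ≥ 3 and β₁, β₂ ∈ (0,1). Define the periodic gradient sequence g_t (t ≥ 1) by g_t = P if t mod P = 1 and g_t = −1 otherwise; define m_0 = 0, m_t = β₁ m_{t−1} + (1−β₁) g_t, and S_0 = 0, S_t = β₂ S_{t−1} + (1−β₂)(g_t − m_t)². Then for each j ∈ {1, …, P}, liminf_{k→∞} ( S_{kP+j} − S_{kP} ) ≥ 0; i.e., in the limit k → ∞, S_{kP} is the smallest value of S within each period of length P. -/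
open Filter Topology

/-- An affine recursion with contraction factor `r` and convergent forcing converges. -/
lemma tendsto_of_affine_recursion {r c : ℝ} (hr0 : 0 ≤ r) (hr1 : r < 1) {x w : ℕ → ℝ}
    (hx : ∀ k, x (k + 1) = r * x k + w k) (hw : Tendsto w atTop (𝓝 c)) :
    Tendsto x atTop (𝓝 (c / (1 - r))) := by
  have hne : 0 < 1 - r := by linarith
  rw [Metric.tendsto_atTop]
  intro ε hε
  obtain ⟨N, hN⟩ := Metric.tendsto_atTop.1 hw (ε / 2 * (1 - r)) (by positivity)
  have hfix : c / (1 - r) = r * (c / (1 - r)) + c := by field_simp; ring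
  have hbound : ∀ n, |x (N + n) - c / (1 - r)| ≤ r ^ n * |x N - c / (1 - r)| + ε / 2 := by
    intro n
    induction n with
    | zero => simp; positivity
    | succ n ih =>
      have hwn := hN (N + n) (by omega)
      rw [Real.dist_eq] at hwn
      have heq : x (N + (n + 1)) - c / (1 - r)
          = r * (x (N + n) - c / (1 - r)) + (w (N + n) - c) := by
        rw [← add_assoc, hx]
        linear_combination -hfix
      rw [heq]
      calc _ ≤ |r * (x (N + n) - c / (1 - r))| + |w (N + n) - c| := abs_add_le _ _
        _ = r * |x (N + n) - c / (1 - r)| + |w (N + n) - c| := by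
          rw [abs_mul, abs_of_nonneg hr0]
        _ ≤ r * (r ^ n * |x N - c / (1 - r)| + ε / 2) + ε / 2 * (1 - r) := by gcongr
        _ = _ := by ring
  have hpow : Tendsto (fun n : ℕ => r ^ n * |x N - c / (1 - r)|) atTop (𝓝 0) := by
    simpa using (tendsto_pow_atTop_nhds_zero_of_lt_one hr0 hr1).mul_const |x N - c / (1 - r)|
  obtain ⟨K, hK⟩ := eventually_atTop.1 (hpow.eventually (gt_mem_nhds (half_pos hε)))
  refine ⟨N + K, fun n hn => ?_⟩
  obtain ⟨i, rfl⟩ := Nat.exists_eq_add_of_le (show N ≤ n by omega)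
  have h₁ := hbound i
  have h₂ := hK i (by omega)
  rw [Real.dist_eq]
  linarith

/-- An exponential moving average of an asymptotically `P`-periodic sequence is asymptotically
`P`-periodic, and its limits along residue classes satisfy the same recursion. -/
lemma exists_periodic_limit_of_ema {P : ℕ} (hP : P ≠ 0) {r : ℝ} (hr0 : 0 ≤ r) (hr1 : r < 1)
    {x w : ℕ → ℝ} {ω : ℕ → ℝ} (hx : ∀ t, x (t + 1) = r * x t + (1 - r) * w t)
    (hw : ∀ j, Tendsto (fun k => w (k * P + j)) atTop (𝓝 (ω j))) :
    ∃ s : ℕ → ℝ, s P = s 0 ∧ (∀ j, s (j + 1) = r * s j + (1 - r) * ω j) ∧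
      ∀ j, Tendsto (fun k => x (k * P + j)) atTop (𝓝 (s j)) := by
  have hforce : ∀ j, ∃ c, Tendsto (fun k => x (k * P + j) - r ^ j * x (k * P)) atTop (𝓝 c) := by
    intro j
    induction j with
    | zero => exact ⟨0, by simp⟩
    | succ j ih =>
      obtain ⟨c, hc⟩ := ih
      refine ⟨r * c + (1 - r) * ω j,
        ((hc.const_mul r).add ((hw j).const_mul (1 - r))).congr fun k => ?_⟩
      rw [← add_assoc, hx]
      ring
  obtain ⟨c, hc⟩ := hforce P
  have hbase := tendsto_of_affine_recursion (pow_nonneg hr0 P) (pow_lt_one₀ hr0 hr1 hP)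
    (x := fun k => x (k * P)) (fun k => by simp only [Nat.succ_mul]; ring) hc
  have hlim : ∀ j, ∃ s, Tendsto (fun k => x (k * P + j)) atTop (𝓝 s) := by
    intro j
    obtain ⟨d, hd⟩ := hforce j
    exact ⟨_, (hd.add (hbase.const_mul (r ^ j))).congr fun k => by ring⟩
  choose s hs using hlim
  refine ⟨s, ?_, fun j => ?_, hs⟩
  · refine tendsto_nhds_unique (hs P) (((hs 0).comp (tendsto_add_atTop_nat 1)).congr fun k => ?_)
    simp [Nat.succ_mul]
  · refine tendsto_nhds_unique (hs (j + 1))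
      ((((hs j).const_mul r).add ((hw j).const_mul (1 - r))).congr fun k => ?_)
    rw [← add_assoc, hx]

/-- The periodic moving average of a forcing that is nonincreasing over the period is minimal at
the end of the period. -/
lemma ema_min_at_period_end {P : ℕ} {b : ℝ} (hb0 : 0 < b) (hb1 : b < 1) {s δ : ℕ → ℝ}
    (hper : s P = s 0) (hs : ∀ j, s (j + 1) = b * s j + (1 - b) * δ j)
    (hδ : ∀ j, j + 1 < P → δ (j + 1) ≤ δ j) {j : ℕ} (hj : j ≤ P) : s 0 ≤ s j := by
  have hdrop : ∀ i, i < P → s (i + 1) < s 0 → δ i ≤ s (i + 1) := by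
    intro i
    induction i with
    | zero =>
      intro _ h
      have := hs 0
      nlinarith
    | succ i ih =>
      intro hi h
      have h₁ := hs (i + 1)
      have h₂ := hδ i hi
      rcases lt_or_ge (s (i + 1)) (s 0) with h₃ | h₃
      · have := ih (by omega) h₃
        nlinarith
      · nlinarith
  by_contra! hlt
  have hstay : ∀ i, j ≤ i → i ≤ P → s i < s 0 := by
    intro i hji
    induction i, hji using Nat.le_induction with
    | base => exact fun _ => hlt
    | succ i _ ih =>
      intro hi
      have h₁ := ih (by omega)
      cases i with
      | zero => exact absurd h₁ (lt_irrefl _)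
      | succ i =>
        have h₂ := hdrop i (by omega) h₁
        have h₃ := hδ i hi
        have h₄ := hs (i + 1)
        nlinarith
  exact absurd (hstay P hj le_rfl) (by rw [hper]; exact lt_irrefl _)

/-- In the limit `k → ∞`, `S (kP)` is the smallest value of `S` within each period:
for each `j ∈ {1, …, P}`, `liminf_{k→∞} (S (kP + j) - S (kP)) ≥ 0`. -/
theorem centered_second_momentum_min_in_period
    (P : ℕ) (hP : 3 ≤ P) (β₁ β₂ : ℝ)
    (hβ₁ : β₁ ∈ Set.Ioo (0 : ℝ) 1) (hβ₂ : β₂ ∈ Set.Ioo (0 : ℝ) 1)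
    (g m S : ℕ → ℝ)
    (hg : ∀ t, 1 ≤ t → g t = if t % P = 1 then (P : ℝ) else -1)
    (hm0 : m 0 = 0)
    (hm : ∀ t, 1 ≤ t → m t = β₁ * m (t - 1) + (1 - β₁) * g t)
    (hS0 : S 0 = 0)
    (hS : ∀ t, 1 ≤ t → S t = β₂ * S (t - 1) + (1 - β₂) * (g t - m t) ^ 2) :
    ∀ j, 1 ≤ j → j ≤ P →
      0 ≤ Filter.liminf (fun k => S (k * P + j) - S (k * P)) Filter.atTop := by
  intro j _ hjP
  obtain ⟨ha0, ha1⟩ := hβ₁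
  obtain ⟨hb0, hb1⟩ := hβ₂
  have hgper : ∀ i, Tendsto (fun k => g (k * P + i + 1)) atTop (𝓝 (g (i + 1))) := by
    intro i
    refine tendsto_const_nhds.congr fun k => ?_
    rw [hg _ (by omega), hg _ (by omega), show k * P + i + 1 = i + 1 + k * P by ring,
      Nat.add_mul_mod_self_right]
  obtain ⟨μ, hμper, hμ, hμlim⟩ := exists_periodic_limit_of_ema (by omega) ha0.le ha1
    (w := fun t => g (t + 1)) (fun t => hm (t + 1) (by omega)) hgper
  obtain ⟨s, hsper, hs, hslim⟩ := exists_periodic_limit_of_ema (by omega) hb0.le hb1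
    (w := fun t => (g (t + 1) - m (t + 1)) ^ 2) (fun t => hS (t + 1) (by omega))
    (fun i => ((hgper i).sub (hμlim (i + 1))).pow 2)
  have hg1 : g (0 + 1) = P := by
    rw [hg _ (by omega), if_pos (Nat.mod_eq_of_lt (by omega))]
  have hgneg : ∀ i, i + 2 ≤ P → g (i + 1 + 1) = -1 := by
    intro i hi
    rw [hg _ (by omega), if_neg]
    rcases hi.eq_or_lt with rfl | hi
    · simp
    · rw [Nat.mod_eq_of_lt hi]; omega
  have hν : ∀ i, i + 1 ≤ P → μ (i + 1) + 1 = β₁ ^ i * (μ 1 + 1) := by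
    intro i
    induction i with
    | zero => simp
    | succ i ih =>
      intro hi
      rw [hμ, hgneg i hi, pow_succ]
      linear_combination β₁ * ih (by omega)
  have hμ1 := hμ 0
  rw [hg1, ← hμper] at hμ1
  obtain ⟨n, rfl⟩ : ∃ n, P = n + 3 := ⟨P - 3, by omega⟩
  have hend := hν (n + 2) le_rfl
  have hpow : β₁ ^ (n + 3) ≤ β₁ ^ 2 := pow_le_pow_of_le_one ha0.le ha1.le (by omega)
  have hpow_lt : β₁ ^ (n + 3) < 1 := pow_lt_one₀ ha0.le ha1 (by omega)
  set p : ℝ := ((n + 3 : ℕ) : ℝ) with hp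
  have hp0 : 0 ≤ p := Nat.cast_nonneg _
  have hsolve : (μ 1 + 1) * (1 - β₁ ^ (n + 3)) = (1 - β₁) * (p + 1) := by
    have : β₁ ^ (n + 3) = β₁ * β₁ ^ (n + 2) := by ring
    rw [this]
    simp only [zero_add] at hμ1
    linear_combination hμ1 + β₁ * hend
  have hν1 : 0 ≤ μ 1 + 1 := by
    by_contra! h
    nlinarith [mul_nonneg (sub_nonneg.2 ha1.le) (add_nonneg hp0 zero_le_one)]
  have hν1le : (1 + β₁) * (μ 1 + 1) ≤ p + 1 := by
    have : (μ 1 + 1) * (1 - β₁ ^ 2) ≤ (1 - β₁) * (p + 1) := by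
      rw [← hsolve]; gcongr
    refine le_of_mul_le_mul_left ?_ (sub_pos.2 ha1)
    linarith
  have hdecr : ∀ i, i + 1 < n + 3 →
      (g (i + 1 + 1) - μ (i + 1 + 1)) ^ 2 ≤ (g (i + 1) - μ (i + 1)) ^ 2 := by
    intro i hi
    have hnext : g (i + 1 + 1) - μ (i + 1 + 1) = -(β₁ * (μ (i + 1) + 1)) := by
      rw [hμ, hgneg i (by omega)]; ring
    rw [hnext, neg_sq]
    cases i with
    | zero =>
      rw [hg1]
      simp only [zero_add]
      gcongr
      linarith
    | succ i =>
      have : g (i + 1 + 1) - μ (i + 1 + 1) = -(μ (i + 1 + 1) + 1) := by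
        rw [hgneg i (by omega)]; ring
      rw [this, neg_sq, mul_pow]
      exact mul_le_of_le_one_left (sq_nonneg _) (pow_le_one₀ ha0.le ha1.le)
  have hmin := ema_min_at_period_end hb0 hb1 hsper hs hdecr hjP
  have hlim := (hslim j).sub (hslim 0)
  simp only [add_zero] at hlim
  rw [hlim.liminf_eq]
  linarith
end
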